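/- arXiv:1512.01369 — 3 statements merged into one kernel-verified Lean document; each statement's English description precedes it below -/
import Mathlib

section
/- There exists c ∈ (0,1) such that for every free group F, every integer n ≥ 3, and every finite nonempty subset A ⊆ F that is not contained in any cyclic subgroup of F, one has |Aⁿ| ≥ cⁿ · |A|^{⌊(n+1)/2⌋}. -/
open Pointwise

namespace FreeGroup

/-- Free groups are residually finite: a nontrivial element acts nontrivially on a finite set. -/
theorem exists_perm_rep_ne_one {α : Type*} {x : FreeGroup α} (hx : x ≠ 1) :
    ∃ (B : Set (FreeGroup α)), B.Finite ∧ ∃ φ : FreeGroup α →* Equiv.Perm B, φ x ≠ 1 := by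
  classical
  set B : Set (FreeGroup α) := {w | ∃ l, l <:+ x.toWord ∧ mk l = w} with hB
  have hBfin : B.Finite := by
    have : B = mk '' {l | l <:+ x.toWord} := by ext; simp [hB]
    rw [this]
    refine Set.Finite.image _ ?_
    refine (x.toWord.tails.toFinset.finite_toSet).subset fun l hl => ?_
    simpa using hl
  have : Finite B := hBfin
  refine ⟨B, hBfin, ?_⟩
  let e (a : α) : {w : B // of a * w.1 ∈ B} ≃ {w : B // (of a)⁻¹ * w.1 ∈ B} :=
    { toFun := fun w => ⟨⟨of a * w.1.1, w.2⟩, by simp⟩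
      invFun := fun w => ⟨⟨(of a)⁻¹ * w.1.1, w.2⟩, by simp⟩
      left_inv := fun w => by simp
      right_inv := fun w => by simp }
  have := Fintype.ofFinite B
  let σ (a : α) : Equiv.Perm B := (e a).extendSubtype
  have hσ (a : α) (w : B) (h : of a * w.1 ∈ B) : ((σ a) w).1 = of a * w.1 := by
    have := (e a).extendSubtype_apply_of_mem w h
    simp only [σ, this]
    rfl
  have hσ' (a : α) (w : B) (h : (of a)⁻¹ * w.1 ∈ B) : ((σ a)⁻¹ w).1 = (of a)⁻¹ * w.1 := by
    have : σ a ⟨_, h⟩ = w := Subtype.ext (by rw [hσ]; simp; simp [w.2])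
    conv_lhs => rw [← this]
    simp
  have h1 : (1 : FreeGroup α) ∈ B := ⟨[], by simp, rfl⟩
  have key : ∀ l, l <:+ x.toWord → ((lift σ (mk l)) ⟨1, h1⟩ : B).1 = mk l := by
    intro l
    induction l with
    | nil => intro _; rw [← one_eq_mk]; simp
    | cons c l ih =>
      intro hl
      have hl' : l <:+ x.toWord := (List.suffix_cons c l).trans hl
      have ih := ih hl'
      obtain ⟨a, s⟩ := c
      have hmem : mk ((a, s) :: l) ∈ B := ⟨_, hl, rfl⟩
      have hmul : mk ((a, s) :: l) = mk [(a, s)] * mk l := by simp [mul_mk]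
      rw [hmul] at hmem ⊢
      rw [_root_.map_mul, Equiv.Perm.mul_apply]
      cases s with
      | true =>
        have : mk [(a, true)] = of a := rfl
        rw [this] at hmem ⊢
        rw [lift_apply_of, hσ, ih]
        rwa [ih]
      | false =>
        have : mk [(a, false)] = (of a)⁻¹ := rfl
        rw [this] at hmem ⊢
        rw [_root_.map_inv, lift_apply_of, hσ', ih]
        rwa [ih]
  refine ⟨lift σ, fun h => hx ?_⟩
  have := key x.toWord List.suffix_rfl
  rw [mk_toWord, h] at this
  exact this.symm

/-- Finitely generated free groups are Hopfian. -/
theorem injective_of_surjective_endo {ι : Type*} [Finite ι] (f : FreeGroup ι →* FreeGroup ι)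
    (hf : Function.Surjective f) : Function.Injective f := by
  refine (injective_iff_map_eq_one f).2 fun x hx => ?_
  by_contra hne
  obtain ⟨B, hB, φ, hφ⟩ := exists_perm_rep_ne_one hne
  have : Finite B := hB
  have : Finite (FreeGroup ι →* Equiv.Perm B) := Finite.of_equiv _ (lift (α := ι))
  have hinj : Function.Injective fun ψ : FreeGroup ι →* Equiv.Perm B => ψ.comp f :=
    fun ψ ψ' h => (MonoidHom.cancel_right hf).1 h
  obtain ⟨ψ, rfl⟩ := (Finite.injective_iff_surjective.1 hinj) φ
  simp [hx] at hφ

theorem commute_of_subsingleton {ι : Type*} [Subsingleton ι] (x y : FreeGroup ι) :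
    Commute x y := by
  have h1 (i : ι) (y : FreeGroup ι) : Commute (of i) y := by
    induction y using FreeGroup.induction_on with
    | C1 => simp
    | of j => rw [Subsingleton.elim i j]
    | inv_of j h => exact h.inv_right
    | mul a b ha hb => exact ha.mul_right hb
  induction x using FreeGroup.induction_on with
  | C1 => simp
  | of j => exact h1 j y
  | inv_of j h => exact h.inv_left
  | mul a b ha hb => exact ha.mul_left hb

theorem eq_of_commute_of {ι : Type*} {i j : ι} (h : Commute (of i) (of j)) : i = j := by
  classical
  by_contra hne
  have := congrArg toWord h.eq
  simp [toWord_mul, reduce.cons, hne] at this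

/-- A set of pairwise commuting elements lies in a cyclic subgroup. -/
theorem exists_zpowers_of_commute {α : Type*} (S : Set (FreeGroup α))
    (hS : ∀ x ∈ S, ∀ y ∈ S, Commute x y) :
    ∃ g : FreeGroup α, S ⊆ (Subgroup.zpowers g : Subgroup (FreeGroup α)) := by
  set H := Subgroup.closure S
  have hcomm : ∀ x y : H, Commute x y := by
    intro x y
    have := Subgroup.isMulCommutative_closure (k := S) (fun x hx y hy => hS x hx y hy)
    exact this.is_comm.comm x y
  let e := IsFreeGroup.toFreeGroup H
  have hsub : Subsingleton (IsFreeGroup.Generators H) := by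
    refine ⟨fun i j => eq_of_commute_of ?_⟩
    have := (hcomm (e.symm (of i)) (e.symm (of j))).map e.toMonoidHom
    simpa using this
  suffices ∃ g : H, ∀ x : H, x ∈ Subgroup.zpowers g by
    obtain ⟨g, hg⟩ := this
    refine ⟨g, fun x hx => ?_⟩
    obtain ⟨n, hn⟩ := hg ⟨x, Subgroup.subset_closure hx⟩
    exact ⟨n, by simpa using congrArg Subtype.val hn⟩
  suffices ∃ g : FreeGroup (IsFreeGroup.Generators H), ∀ x, x ∈ Subgroup.zpowers g by
    obtain ⟨g, hg⟩ := this
    refine ⟨e.symm g, fun x => ?_⟩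
    obtain ⟨n, hn⟩ := hg (e x)
    refine ⟨n, ?_⟩
    have := congrArg e.symm hn
    simpa using this
  rcases isEmpty_or_nonempty (IsFreeGroup.Generators H) with h | ⟨⟨i⟩⟩
  · exact ⟨1, fun x => by rw [Subsingleton.elim x 1]; exact one_mem _⟩
  · refine ⟨of i, fun x => ?_⟩
    induction x using FreeGroup.induction_on with
    | C1 => exact one_mem _
    | of j => rw [Subsingleton.elim j i]; exact Subgroup.mem_zpowers _
    | inv_of j h => exact inv_mem h
    | mul a b ha hb => exact mul_mem ha hb

/-- Two non-commuting elements of a free group freely generate a free group of rank two. -/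
theorem lift_injective_of_not_commute {α : Type*} {x y : FreeGroup α} (hxy : ¬ Commute x y) :
    Function.Injective (lift (fun b : Bool => cond b x y)) := by
  set f := lift (fun b : Bool => cond b x y) with hf
  let e := IsFreeGroup.toFreeGroup f.range
  set ι := IsFreeGroup.Generators f.range
  have hgsurj : Function.Surjective (e.toMonoidHom.comp f.rangeRestrict) :=
    e.surjective.comp f.rangeRestrict_surjective
  have hnt : Nontrivial ι := by
    rw [← not_subsingleton_iff_nontrivial]
    intro hsub
    apply hxy
    have := commute_of_subsingleton (e (f.rangeRestrict (of true))) (e (f.rangeRestrict (of false)))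
    have := (this.map e.symm.toMonoidHom).map f.range.subtype
    simpa [hf] using this
  have hinj : Function.Injective fun ψ : FreeGroup ι →* Multiplicative (ZMod 2) =>
      ψ.comp (e.toMonoidHom.comp f.rangeRestrict) :=
    fun ψ ψ' h => (MonoidHom.cancel_right hgsurj).1 h
  have hinj2 : Function.Injective fun s : ι → Multiplicative (ZMod 2) =>
      (lift (α := Bool)).symm ((lift s).comp (e.toMonoidHom.comp f.rangeRestrict)) :=
    (lift (α := Bool)).symm.injective.comp (hinj.comp (lift (α := ι)).injective)
  have hfin : Finite ι := by
    have : Finite (ι → Multiplicative (ZMod 2)) := Finite.of_injective _ hinj2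
    classical
    refine Finite.of_injective
      (fun i : ι => (Pi.mulSingle i (Multiplicative.ofAdd 1) : ι → Multiplicative (ZMod 2))) ?_
    intro i j hij
    by_contra hne
    have := congrFun hij i
    simp [hne] at this
  have hcard : Nat.card ι = Nat.card Bool := by
    have h1 := Nat.card_le_card_of_injective _ hinj2
    have h2 : 1 < Nat.card ι := Finite.one_lt_card
    have := Fintype.ofFinite ι
    simp [Nat.card_pi] at h1 h2 ⊢
    have := (Nat.pow_le_pow_iff_right (a := 2) (by norm_num) (n := Fintype.card ι) (m := 2)).1
      (by simpa using h1)
    omega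
  let E : ι ≃ Bool := (Finite.card_eq.1 hcard).some
  have := injective_of_surjective_endo ((freeGroupCongr E).toMonoidHom.comp
    (e.toMonoidHom.comp f.rangeRestrict)) ((freeGroupCongr E).surjective.comp hgsurj)
  have h2 : Function.Injective f.rangeRestrict := by
    rw [MonoidHom.coe_comp, MonoidHom.coe_comp] at this
    exact this.of_comp.of_comp
  exact (f.rangeRestrict_injective_iff).1 h2

/-- The elements whose reduced word does not involve the inverse of the generator `false`. -/
def posFalse : Submonoid (FreeGroup Bool) where
  carrier := {q | (false, false) ∉ q.toWord}
  one_mem' := by simp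
  mul_mem' := by
    intro a b ha hb h
    have := (toWord_mul_sublist a b).subset h
    simp only [List.mem_append] at this
    exact this.elim ha hb

theorem of_true_zpow_mem_posFalse (n : ℤ) : (of true) ^ n ∈ posFalse := by
  obtain ⟨n, rfl | rfl⟩ := n.eq_nat_or_neg
  · simp [posFalse, toWord_of_pow]
  · simp [posFalse, toWord_inv, toWord_of_pow, invRev]

theorem of_false_mem_posFalse : of false ∈ posFalse := by simp [posFalse]

theorem toWord_of_false_mul {q : FreeGroup Bool} (hq : q ∈ posFalse) :
    (of false * q).toWord = (false, true) :: q.toWord := by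
  have hq' : (false, false) ∉ q.toWord := hq
  rw [toWord_mul, toWord_of, List.singleton_append, reduce.cons, reduce_toWord]
  cases h : q.toWord with
  | nil => rfl
  | cons c l =>
    rw [h] at hq'
    obtain ⟨a, s⟩ := c
    cases a <;> cases s <;> simp_all

theorem toWord_of_true_pow_mul (n : ℕ) {q : FreeGroup Bool} (hq : q ∈ posFalse) :
    (of true ^ n * (of false * q)).toWord =
      List.replicate n (true, true) ++ (false, true) :: q.toWord := by
  induction n with
  | zero => simpa using toWord_of_false_mul hq
  | succ n ih =>
    rw [pow_succ', mul_assoc, toWord_mul, toWord_of, List.singleton_append, reduce.cons,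
      reduce_toWord, ih]
    cases n <;> simp [List.replicate_succ]

theorem zpow_eq_of_mul_eq {n m : ℤ} {q r : FreeGroup Bool} (hq : q ∈ posFalse)
    (hr : r ∈ posFalse) (h : of true ^ n * of false * q = of true ^ m * of false * r) : n = m := by
  wlog hnm : m ≤ n generalizing n m q r
  · exact (this hr hq h.symm (by omega)).symm
  obtain ⟨k, rfl⟩ := Int.le.dest hnm
  have h' : of true ^ k * (of false * q) = of true ^ 0 * (of false * r) := by
    rw [zpow_add, zpow_natCast, mul_assoc, mul_assoc, mul_assoc, mul_left_cancel_iff] at h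
    simpa using h
  have := congrArg toWord h'
  rw [toWord_of_true_pow_mul _ hq, toWord_of_true_pow_mul _ hr] at this
  cases k with
  | zero => simp
  | succ k => simp [List.replicate_succ] at this

/-- Commutation is transitive on nontrivial elements of a free group. -/
theorem commute_trans {α : Type*} {x y z : FreeGroup α} (hx : x ≠ 1) (hy : Commute x y)
    (hz : Commute x z) : Commute y z := by
  by_contra hyz
  have pow_rel : ∀ {y : FreeGroup α}, Commute x y → y ≠ 1 →
      ∃ i j : ℤ, i ≠ 0 ∧ j ≠ 0 ∧ y ^ i = x ^ j := by
    intro y hy hy1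
    obtain ⟨g, hg⟩ := exists_zpowers_of_commute {x, y} (by
      rintro a (rfl | rfl) b (rfl | rfl)
      exacts [.refl _, hy, hy.symm, .refl _])
    obtain ⟨i, hi⟩ := hg (Set.mem_insert x {y})
    obtain ⟨j, hj⟩ := hg (Set.mem_insert_of_mem x (Set.mem_singleton y))
    simp only at hi hj
    refine ⟨i, j, ?_, ?_, ?_⟩
    · rintro rfl; simp at hi; exact hx hi.symm
    · rintro rfl; simp at hj; exact hy1 hj.symm
    · rw [← hi, ← hj, ← zpow_mul, ← zpow_mul, mul_comm]
  obtain ⟨i, j, hi, hj, hij⟩ := pow_rel hy (by rintro rfl; simp at hyz)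
  obtain ⟨k, l, hk, hl, hkl⟩ := pow_rel hz (by rintro rfl; simp at hyz)
  have hyk : Commute y (z ^ (k * j).natAbs) := by
    have h1 : Commute y (z ^ (k * j)) := by
      have : z ^ (k * j) = y ^ (i * l) := by
        rw [zpow_mul, hkl, zpow_mul y, hij, ← zpow_mul, ← zpow_mul, mul_comm]
      rw [this]
      exact (Commute.refl y).zpow_right _
    rcases Int.natAbs_eq (k * j) with h | h
    · rw [h, zpow_natCast] at h1; exact h1
    · rw [h, zpow_neg, zpow_natCast] at h1; simpa using h1
  have hpos : (k * j).natAbs ≠ 0 := by simp [hk, hj]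
  obtain ⟨m, hm⟩ := Nat.exists_eq_succ_of_ne_zero hpos
  rw [hm] at hyk
  have hcomm : Commute (of true) (of false ^ (m + 1)) := by
    apply lift_injective_of_not_commute hyz
    simpa using hyk.eq
  have hb : ∀ n : ℕ, of false ^ n ∈ posFalse := fun n => pow_mem of_false_mem_posFalse n
  have := zpow_eq_of_mul_eq (n := 1) (m := 0) (hb m)
    (mul_mem (hb m) (by simpa using of_true_zpow_mem_posFalse 1)) (by
      have := hcomm.eq
      rw [pow_succ'] at this
      simpa [mul_assoc] using this)
  omega

end FreeGroup

namespace List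

variable {β : Type*}

/-- The `n`-fold repetition of a word. -/
def wpow (r : List β) (n : ℕ) : List β := (replicate n r).flatten

theorem wpow_zero (r : List β) : wpow r 0 = [] := rfl

theorem wpow_succ (r : List β) (n : ℕ) : wpow r (n + 1) = r ++ wpow r n := by
  simp [wpow, replicate_succ]

theorem wpow_one (r : List β) : wpow r 1 = r := by simp [wpow]

theorem length_wpow (r : List β) (n : ℕ) : (wpow r n).length = n * r.length := by
  simp [wpow]

theorem append_wpow_comm {t r : List β} (h : t ++ r = r ++ t) (n : ℕ) :
    t ++ wpow r n = wpow r n ++ t := by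
  induction n with
  | zero => simp [wpow_zero]
  | succ n ih => rw [wpow_succ, ← append_assoc, h, append_assoc, ih, append_assoc]

theorem wpow_succ' (r : List β) (n : ℕ) : wpow r (n + 1) = wpow r n ++ r := by
  rw [wpow_succ, append_wpow_comm rfl]

theorem wpow_add (r : List β) (m n : ℕ) : wpow r (m + n) = wpow r m ++ wpow r n := by
  induction m with
  | zero => simp [wpow_zero]
  | succ m ih => rw [Nat.succ_add_eq_add_succ, Nat.add_succ, wpow_succ, ih, wpow_succ, append_assoc]

theorem prefix_wpow_append {v r : List β} (h : v <+: r ++ v) (n : ℕ) : v <+: wpow r n ++ v := by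
  induction n with
  | zero => simp [wpow_zero]
  | succ n ih =>
    rw [wpow_succ, append_assoc]
    exact h.trans ((prefix_append_right_inj r).2 ih)

theorem prefix_wpow {v r : List β} (hr : r ≠ []) (h : v <+: r ++ v) {n : ℕ} (hn : v.length ≤ n) :
    v <+: wpow r n := by
  refine prefix_of_prefix_length_le (prefix_wpow_append h n) (prefix_append _ _) ?_
  rw [length_wpow]
  have := length_pos_iff.2 hr
  nlinarith

/-- A period of a word may be replaced by any word commuting with it. -/
theorem prefix_append_of_comm {v r t : List β} (hr : r ≠ []) (h : v <+: r ++ v)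
    (ht : t ++ r = r ++ t) : v <+: t ++ v := by
  have h1 := prefix_wpow hr h le_rfl
  refine prefix_of_prefix_length_le (h1.trans (prefix_append _ t)) ?_ (by simp)
  rw [← append_wpow_comm ht]
  exact (prefix_append_right_inj t).2 h1

/-- Two words with a common period are comparable. -/
theorem prefix_of_common_period {v w r : List β} (hr : r ≠ []) (hv : v <+: r ++ v)
    (hw : w <+: r ++ w) (hvw : v.length ≤ w.length) : v <+: w :=
  prefix_of_prefix_length_le (prefix_wpow hr hv hvw) (prefix_wpow hr hw le_rfl) hvw

/-- Two short periods of a word commute. -/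
theorem append_comm_of_periods {v r s : List β} (hr : v <+: r ++ v) (hs : v <+: s ++ v)
    (h : r.length + s.length ≤ v.length) : r ++ s = s ++ r := by
  have aux : ∀ {r s : List β}, v <+: r ++ v → v <+: s ++ v → r.length + s.length ≤ v.length →
      r ++ s <+: v := by
    intro r s hr hs h
    have h1 : s <+: v := prefix_of_prefix_length_le (prefix_append s v) hs (by omega)
    exact prefix_of_prefix_length_le ((prefix_append_right_inj r).2 h1) hr (by simpa using h)
  have h1 := aux hr hs h
  have h2 := aux hs hr (by omega)
  exact (prefix_of_prefix_length_le h1 h2 (by simp; omega)).eq_of_length (by simp; omega)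

/-- `r` is a nontrivial period of `v` of length at most half of that of `v`. -/
def IsShortPeriod (r v : List β) : Prop := r ≠ [] ∧ v <+: r ++ v ∧ 2 * r.length ≤ v.length

/-- `r` generates all the short periods of `v`. -/
def IsPeriodRoot (r v : List β) : Prop :=
  IsShortPeriod r v ∧ ∀ s, IsShortPeriod s v → ∃ k, 1 ≤ k ∧ s = wpow r k

theorem exists_isPeriodRoot {v : List β} (h : ∃ r, IsShortPeriod r v) : ∃ r, IsPeriodRoot r v := by
  classical
  have hex : ∃ n, ∃ r, IsShortPeriod r v ∧ r.length = n := h.elim fun r hr => ⟨_, r, hr, rfl⟩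
  obtain ⟨r, hr, hlen⟩ := Nat.find_spec hex
  have hmin : ∀ s, IsShortPeriod s v → r.length ≤ s.length := fun s hs => by
    rw [hlen]; exact Nat.find_min' hex ⟨s, hs, rfl⟩
  refine ⟨r, hr, ?_⟩
  have main : ∀ n s, s.length = n → IsShortPeriod s v → ∃ k, 1 ≤ k ∧ s = wpow r k := by
    intro n
    induction n using Nat.strong_induction_on with
    | _ n ih =>
    intro s hsn hs
    have hcomm : s ++ r = r ++ s := append_comm_of_periods hs.2.1 hr.2.1 (by
      have := hs.2.2; have := hr.2.2; omega)
    obtain ⟨t, rfl⟩ : r <+: s := prefix_of_prefix_length_le (prefix_append r s)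
      (hcomm ▸ prefix_append s r) (hmin s hs)
    rcases eq_or_ne t [] with rfl | ht
    · exact ⟨1, le_rfl, by simp [wpow_one]⟩
    have htr : t ++ r = r ++ t := by simpa using hcomm
    have htper : v <+: t ++ v := prefix_append_of_comm hs.1 hs.2.1 (by
      rw [← append_assoc, htr])
    have hrpos := length_pos_iff.2 hr.1
    have hlen2 := hs.2.2
    simp only [length_append] at hsn hlen2
    obtain ⟨k, hk, hk'⟩ := ih t.length (by omega) t rfl ⟨ht, htper, by omega⟩
    exact ⟨k + 1, by omega, by rw [wpow_succ, ← hk']⟩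
  exact fun s hs => main _ s rfl hs

/-- The elements of `U` that can be prolonged inside `U` by a nontrivial power of `r`. -/
noncomputable def prolongable [DecidableEq β] (U : Finset (List β)) (r : List β) : Finset (List β) :=
  open Classical in U.filter fun u => ∃ k, 1 ≤ k ∧ u ++ wpow r k ∈ U

theorem exists_injOn_prolongation [DecidableEq β] (U : Finset (List β)) {r : List β} (hr : r ≠ []) :
    ∃ f : List β → List β, Set.InjOn f (prolongable U r) ∧
      ∀ u ∈ prolongable U r, f u ∈ U ∧ ∃ k, 1 ≤ k ∧ f u = u ++ wpow r k := by
  classical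
  have hrpos := length_pos_iff.2 hr
  refine ⟨fun u => if h : ∃ k, 1 ≤ k ∧ u ++ wpow r k ∈ U then u ++ wpow r (Nat.find h) else u, ?_, ?_⟩
  · have aux : ∀ u u' : List β, ∀ (h : ∃ k, 1 ≤ k ∧ u ++ wpow r k ∈ U)
        (h' : ∃ k, 1 ≤ k ∧ u' ++ wpow r k ∈ U), u' ∈ U →
        u ++ wpow r (Nat.find h) = u' ++ wpow r (Nat.find h') → Nat.find h ≤ Nat.find h' := by
      intro u u' h h' hu' he
      by_contra! hlt
      obtain ⟨d, hd⟩ := Nat.exists_eq_add_of_lt hlt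
      rw [show Nat.find h = (d + 1) + Nat.find h' by omega, wpow_add, ← append_assoc] at he
      have := append_cancel_right he
      exact Nat.find_min h (m := d + 1) (by have := (Nat.find_spec h').1; omega) ⟨by omega, this ▸ hu'⟩
    intro u hu u' hu' he
    simp only [prolongable, Finset.mem_coe, Finset.mem_filter] at hu hu'
    simp only [hu.2, hu'.2, dif_pos] at he
    have := le_antisymm (aux u u' hu.2 hu'.2 hu'.1 he) (aux u' u hu'.2 hu.2 hu.1 he.symm)
    rw [this] at he
    exact append_cancel_right he
  · intro u hu
    simp only [prolongable, Finset.mem_filter] at hu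
    simp only [hu.2, dif_pos]
    exact ⟨(Nat.find_spec hu.2).2, _, (Nat.find_spec hu.2).1, rfl⟩

theorem comm_of_suffix {r s u : List β} {k : ℕ} (hk : 1 ≤ k) (hr : r ≠ [])
    (hrs : r.length ≤ s.length) (h1 : s ++ s <:+ u) (h2 : s ++ s <:+ u ++ wpow r k) :
    r ++ s = s ++ r := by
  have hS : s ++ s <:+ (s ++ s) ++ wpow r k := by
    refine suffix_of_suffix_length_le h2 ?_ (by simp)
    obtain ⟨t, rfl⟩ := h1
    exact ⟨t, by simp⟩
  have hne : (wpow r k).reverse ≠ [] := by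
    obtain ⟨k, rfl⟩ := Nat.exists_eq_add_of_le' hk
    simp [wpow_succ, hr]
  have h3 : (s ++ s).reverse <+: r.reverse ++ (s ++ s).reverse := by
    refine prefix_append_of_comm (r := (wpow r k).reverse) hne ?_ ?_
    · rw [← reverse_append]; exact reverse_prefix.2 hS
    · rw [← reverse_append, ← reverse_append, append_wpow_comm rfl]
  have h4 : (s ++ s).reverse <+: s.reverse ++ (s ++ s).reverse := by
    rw [← reverse_append]; exact reverse_prefix.2 ⟨s, by simp⟩
  have := append_comm_of_periods h3 h4 (by simpa using hrs)
  simpa using (congrArg reverse this).symm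

theorem periodRoot_unique_aux [DecidableEq β] {U : Finset (List β)} {v w r s : List β}
    (hr : IsPeriodRoot r v) (hs : IsPeriodRoot s w) (hrs : r.length ≤ s.length)
    (hUr : 5 * U.card < 6 * (prolongable U r).card)
    (hUs : 5 * U.card < 6 * (prolongable U s).card) : r = s := by
  obtain ⟨f, hfinj, hf⟩ := exists_injOn_prolongation U hr.1.1
  obtain ⟨g, hginj, hg⟩ := exists_injOn_prolongation U hs.1.1
  set P := prolongable U r
  set Q := prolongable U s
  have hPU : P ⊆ U := by simp [P, prolongable]
  have hQU : Q ⊆ U := by simp [Q, prolongable]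
  have hYU : Q.image g ⊆ U := Finset.image_subset_iff.2 fun u hu => (hg u hu).1
  have hYc : (Q.image g).card = Q.card := Finset.card_image_of_injOn hginj
  have two : ∀ {X Y : Finset (List β)}, X ⊆ U → Y ⊆ U → X.card + Y.card ≤ U.card + (X ∩ Y).card := by
    intro X Y hX hY
    rw [← Finset.card_union_add_card_inter]
    gcongr
    exact Finset.union_subset hX hY
  have h1 := two hQU hYU
  set Z := (Q ∩ Q.image g).image g
  have hZU : Z ⊆ U := Finset.image_subset_iff.2 fun u hu => (hg u (Finset.mem_inter.1 hu).1).1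
  have hZc : Z.card = (Q ∩ Q.image g).card := Finset.card_image_of_injOn
    (hginj.mono (by simp))
  have h2 := two hZU hPU
  have hWU : (Z ∩ P).image f ⊆ U :=
    Finset.image_subset_iff.2 fun u hu => (hf u (Finset.mem_inter.1 hu).2).1
  have hWc : ((Z ∩ P).image f).card = (Z ∩ P).card := Finset.card_image_of_injOn
    (hfinj.mono (by simp))
  have h3 := two hZU hWU
  have hpos : 0 < (Z ∩ (Z ∩ P).image f).card := by omega
  obtain ⟨y, hy⟩ := Finset.card_pos.1 hpos
  obtain ⟨hyZ, hyW⟩ := Finset.mem_inter.1 hy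
  obtain ⟨u, hu, rfl⟩ := Finset.mem_image.1 hyW
  obtain ⟨huZ, huP⟩ := Finset.mem_inter.1 hu
  have hZs : ∀ z ∈ Z, s ++ s <:+ z := by
    intro z hz
    obtain ⟨y, hy, rfl⟩ := Finset.mem_image.1 hz
    obtain ⟨hyQ, hy⟩ := Finset.mem_inter.1 hy
    obtain ⟨x, hx, rfl⟩ := Finset.mem_image.1 hy
    obtain ⟨_, k, hk, e1⟩ := hg x hx
    obtain ⟨_, l, hl, e2⟩ := hg _ hyQ
    rw [e2, e1, append_assoc, ← wpow_add]
    obtain ⟨m, hm⟩ : ∃ m, k + l = m + 1 + 1 := ⟨k + l - 2, by omega⟩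
    rw [hm, wpow_succ', wpow_succ']
    exact ⟨x ++ wpow s m, by simp⟩
  obtain ⟨_, k, hk, e⟩ := hf u huP
  have hcomm := comm_of_suffix hk hr.1.1 hrs (hZs _ huZ) (e ▸ hZs _ hyZ)
  obtain ⟨j, hj, hj'⟩ := hs.2 r ⟨hr.1.1, prefix_append_of_comm hs.1.1 hs.1.2.1 hcomm, by
    have := hs.1.2.2; omega⟩
  have hlen := congrArg length hj'
  rw [length_wpow] at hlen
  have := length_pos_iff.2 hs.1.1
  have : j = 1 := by nlinarith
  rw [hj', this, wpow_one]

/-- Given finite sets `U`, `V` of words with the lengths of elements of `U` differing by at most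
half of the length of any element of `V`, either a large part of `U` becomes a prefix code after
appending some fixed `v ∈ V`, or all the elements of `V` share a common short period. -/
theorem exists_prefix_code_or_common_period [DecidableEq β] (U V : Finset (List β))
    (hV : V.Nonempty)
    (hUV : ∀ u ∈ U, ∀ u' ∈ U, ∀ v ∈ V, 2 * u'.length ≤ 2 * u.length + v.length) :
    (∃ v ∈ V, ∃ T ⊆ U, U.card ≤ 6 * T.card ∧
      ∀ u ∈ T, ∀ u' ∈ T, u ++ v <+: u' ++ v → u = u') ∨
    ∃ r, ∀ v ∈ V, IsShortPeriod r v := by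
  by_cases hgood : ∃ v ∈ V, ∃ T ⊆ U, U.card ≤ 6 * T.card ∧
      ∀ u ∈ T, ∀ u' ∈ T, u ++ v <+: u' ++ v → u = u'
  · exact .inl hgood
  right
  push Not at hgood
  have hdecomp : ∀ u ∈ U, ∀ u' ∈ U, ∀ v ∈ V, u ++ v <+: u' ++ v → u ≠ u' →
      ∃ r, u' = u ++ r ∧ IsShortPeriod r v := by
    intro u hu u' hu' v hv h hne
    have hlen := h.length_le
    simp only [length_append] at hlen
    obtain ⟨r, rfl⟩ : u <+: u' := prefix_of_prefix_length_le ((prefix_append u v).trans h)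
      (prefix_append u' v) (by omega)
    have := hUV u hu _ hu' v hv
    simp only [length_append] at this
    refine ⟨r, rfl, by rintro rfl; simp at hne, ?_, by omega⟩
    rwa [append_assoc, prefix_append_right_inj] at h
  have hroot : ∀ v ∈ V, ∃ r, IsPeriodRoot r v ∧ 5 * U.card < 6 * (prolongable U r).card := by
    intro v hv
    obtain ⟨r, hr⟩ : ∃ r, IsPeriodRoot r v := by
      apply exists_isPeriodRoot
      obtain ⟨u, hu, u', hu', h, hne⟩ := hgood v hv U subset_rfl (by omega)
      obtain ⟨r, -, hr⟩ := hdecomp u hu u' hu' v hv h hne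
      exact ⟨r, hr⟩
    refine ⟨r, hr, ?_⟩
    by_contra! hcard
    have hPU : prolongable U r ⊆ U := by simp [prolongable]
    have := Finset.card_sdiff_add_card_eq_card hPU
    obtain ⟨u, hu, u', hu', h, hne⟩ := hgood v hv (U \ prolongable U r) Finset.sdiff_subset (by omega)
    rw [Finset.mem_sdiff] at hu hu'
    obtain ⟨s, rfl, hs⟩ := hdecomp u hu.1 u' hu'.1 v hv h hne
    obtain ⟨k, hk, rfl⟩ := hr.2 s hs
    exact hu.2 (by simp only [prolongable, Finset.mem_filter]; exact ⟨hu.1, k, hk, hu'.1⟩)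
  obtain ⟨v₀, hv₀⟩ := hV
  obtain ⟨r, hr, hrU⟩ := hroot v₀ hv₀
  refine ⟨r, fun v hv => ?_⟩
  obtain ⟨s, hs, hsU⟩ := hroot v hv
  have : r = s := by
    rcases le_total r.length s.length with h | h
    · exact periodRoot_unique_aux hr hs h hrU hsU
    · exact (periodRoot_unique_aux hs hr h hsU hrU).symm
  exact this ▸ hs.1

end List

/-- If the factor `u` can be recovered from a product `u * v * s` with `s` in a set `M` stable under
such products, then products of alternating factors are all distinct. -/
theorem Finset.pow_card_le_card_pow_of_separator {G : Type*} [Group G] [DecidableEq G]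
    {A T : Finset G} {v : G} (hT : T ⊆ A) (hv : v ∈ A) (M : Set G) (hTM : ∀ u ∈ T, u ∈ M)
    (hM : ∀ u ∈ T, ∀ s ∈ M, u * v * s ∈ M)
    (hinj : ∀ u ∈ T, ∀ u' ∈ T, ∀ s ∈ M, ∀ s' ∈ M, u * v * s = u' * v * s' → u = u') (k : ℕ) :
    T.card ^ (k + 1) ≤ (A ^ (2 * k + 1)).card := by
  suffices ∃ S : Finset G, S ⊆ A ^ (2 * k + 1) ∧ (∀ s ∈ S, s ∈ M) ∧ S.card = T.card ^ (k + 1) by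
    obtain ⟨S, hS, -, hc⟩ := this
    exact hc ▸ Finset.card_le_card hS
  induction k with
  | zero => exact ⟨T, by simpa using hT, hTM, by simp⟩
  | succ k ih =>
    obtain ⟨S, hS, hSM, hc⟩ := ih
    refine ⟨(T ×ˢ S).image fun p => p.1 * v * p.2, ?_, ?_, ?_⟩
    · intro x hx
      obtain ⟨⟨u, s⟩, hp, rfl⟩ := Finset.mem_image.1 hx
      obtain ⟨hu, hs⟩ := Finset.mem_product.1 hp
      rw [show 2 * (k + 1) + 1 = (2 * k + 1) + 1 + 1 by ring, pow_succ', pow_succ', ← mul_assoc]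
      exact Finset.mul_mem_mul (Finset.mul_mem_mul (hT hu) hv) (hS hs)
    · intro x hx
      obtain ⟨⟨u, s⟩, hp, rfl⟩ := Finset.mem_image.1 hx
      obtain ⟨hu, hs⟩ := Finset.mem_product.1 hp
      exact hM u hu s (hSM s hs)
    · rw [Finset.card_image_of_injOn, Finset.card_product, hc, pow_succ' _ (k + 1)]
      rintro ⟨u, s⟩ hp ⟨u', s'⟩ hp' h
      obtain ⟨hu, hs⟩ := Finset.mem_product.1 hp
      obtain ⟨hu', hs'⟩ := Finset.mem_product.1 hp'
      simp only at h hu hs hu' hs'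
      obtain rfl := hinj u hu u' hu' s (hSM s hs) s' (hSM s' hs') h
      simpa using h

namespace FreeGroup

variable {α : Type*} [DecidableEq α]

/-- The product `x * y` involves no cancellation. -/
def NoCancel (x y : FreeGroup α) : Prop := (x * y).toWord = x.toWord ++ y.toWord

theorem noCancel_iff {x y : FreeGroup α} : NoCancel x y ↔ IsReduced (x.toWord ++ y.toWord) := by
  rw [NoCancel, toWord_mul, isReduced_iff_reduce_eq]

theorem NoCancel.mul_right {x y z : FreeGroup α} (hxy : NoCancel x y) (hyz : NoCancel y z)
    (hy : y ≠ 1) : NoCancel x (y * z) := by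
  rw [noCancel_iff, hyz, ← List.append_assoc]
  exact (noCancel_iff.1 hxy).append_overlap (noCancel_iff.1 hyz) (by simpa using hy)

theorem NoCancel.inv {x y : FreeGroup α} (h : NoCancel x y) : NoCancel y⁻¹ x⁻¹ := by
  rw [NoCancel, ← mul_inv_rev, toWord_inv, h, toWord_inv, toWord_inv, invRev_append]

theorem pow_card_le_of_prefix_code {A T : Finset (FreeGroup α)} {v : FreeGroup α} (hT : T ⊆ A)
    (hv : v ∈ A) (hv1 : v ≠ 1) (hT1 : 1 ∉ T) (huv : ∀ u ∈ T, NoCancel u v)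
    (hvu : ∀ u ∈ T, NoCancel v u)
    (hcode : ∀ u ∈ T, ∀ u' ∈ T, u.toWord ++ v.toWord <+: u'.toWord ++ v.toWord → u = u') (k : ℕ) :
    T.card ^ (k + 1) ≤ (A ^ (2 * k + 1)).card := by
  have huvs : ∀ u ∈ T, ∀ s, NoCancel v s → (u * v * s).toWord = u.toWord ++ v.toWord ++ s.toWord := by
    intro u hu s hs
    have := (huv u hu).mul_right hs hv1
    rw [NoCancel, hs, ← List.append_assoc, ← mul_assoc] at this
    exact this
  refine Finset.pow_card_le_card_pow_of_separator hT hv {s | NoCancel v s} hvu ?_ ?_ k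
  · intro u hu s hs
    rw [mul_assoc]
    exact (hvu u hu).mul_right ((huv u hu).mul_right hs hv1) fun h => hT1 (h ▸ hu)
  · intro u hu u' hu' s hs s' hs' h
    have h1 := huvs u hu s hs
    have h2 := huvs u' hu' s' hs'
    rw [h, h2] at h1
    have p1 : u.toWord ++ v.toWord <+: u'.toWord ++ v.toWord ++ s'.toWord := h1 ▸ List.prefix_append _ _
    have p2 := List.prefix_append (u'.toWord ++ v.toWord) s'.toWord
    rcases List.prefix_or_prefix_of_prefix p1 p2 with h | h
    · exact hcode u hu u' hu' h
    · exact (hcode u' hu' u hu h).symm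

theorem pow_card_le_or_exists_period {A U V : Finset (FreeGroup α)} (hU : U ⊆ A) (hV : V ⊆ A)
    (hVne : V.Nonempty) (hU1 : 1 ∉ U) (hV1 : 1 ∉ V) (huv : ∀ u ∈ U, ∀ v ∈ V, NoCancel u v)
    (hvu : ∀ u ∈ U, ∀ v ∈ V, NoCancel v u)
    (hlen : ∀ u ∈ U, ∀ u' ∈ U, ∀ v ∈ V, 2 * u'.norm ≤ 2 * u.norm + v.norm) :
    (∀ k : ℕ, U.card ^ (k + 1) ≤ 6 ^ (k + 1) * (A ^ (2 * k + 1)).card) ∨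
      ∃ r, ∀ v ∈ V, List.IsShortPeriod r v.toWord := by
  rcases List.exists_prefix_code_or_common_period (U.image toWord) (V.image toWord)
    (hVne.image _) (by simpa [norm] using hlen) with ⟨v, hv, T, hTU, hTc, hcode⟩ | ⟨r, hr⟩
  · left
    intro k
    obtain ⟨v, hvV, rfl⟩ := Finset.mem_image.1 hv
    obtain ⟨T, hTU', rfl⟩ := Finset.subset_image_iff.1 hTU
    have hTU : T ⊆ U := by simpa using hTU'
    rw [Finset.card_image_of_injective _ toWord_injective,
      Finset.card_image_of_injective _ toWord_injective] at hTc
    have := pow_card_le_of_prefix_code (hTU.trans hU) (hV hvV) (fun h => hV1 (h ▸ hvV))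
      (fun h => hU1 (hTU h)) (fun u hu => huv u (hTU hu) v hvV) (fun u hu => hvu u (hTU hu) v hvV)
      (fun u hu u' hu' h => toWord_injective
        (hcode _ (Finset.mem_image_of_mem _ hu) _ (Finset.mem_image_of_mem _ hu') h)) k
    calc U.card ^ (k + 1) ≤ (6 * T.card) ^ (k + 1) := by gcongr
      _ ≤ _ := by rw [mul_pow]; gcongr
  · right
    exact ⟨r, fun v hv => hr _ (Finset.mem_image_of_mem _ hv)⟩

theorem pow_card_le_of_coset {A V : Finset (FreeGroup α)} (hV : V ⊆ A)
    {x g h : FreeGroup α} (hx : x ≠ 1) (hh : h ∈ A) (hgh : ¬ Commute x (g * h))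
    (hVx : ∀ v ∈ V, Commute x (v * g⁻¹)) (k : ℕ) :
    V.card ^ (k + 1) ≤ (A ^ (2 * k + 1)).card := by
  obtain ⟨w, hw⟩ := exists_zpowers_of_commute {y | Commute x y}
    (fun y hy z hz => commute_trans hx hy hz)
  have hwb : ¬ Commute w (g * h) := by
    intro hc
    obtain ⟨n, hn⟩ := hw (Commute.refl x)
    exact hgh (hn ▸ hc.zpow_left n)
  set φ := lift (fun b : Bool => cond b w (g * h)) with hφ
  have hφinj : Function.Injective φ := lift_injective_of_not_commute hwb
  have hVφ : ∀ v ∈ V, ∃ n : ℤ, v = φ (of true ^ n) * g := by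
    intro v hv
    obtain ⟨n, hn⟩ := hw (hVx v hv)
    exact ⟨n, by simp [hφ]; rw [show w ^ n = v * g⁻¹ from hn]; simp⟩
  have hmul : ∀ (n : ℤ) (q : FreeGroup Bool), φ (of true ^ n) * g * h * (φ q * g) =
      φ (of true ^ n * of false * q) * g := by
    intro n q
    simp [hφ, mul_assoc]
  refine Finset.pow_card_le_card_pow_of_separator hV hh {s | ∃ q ∈ posFalse, s = φ q * g} ?_ ?_ ?_ k
  · intro v hv
    obtain ⟨n, hn⟩ := hVφ v hv
    exact ⟨_, of_true_zpow_mem_posFalse n, hn⟩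
  · rintro v hv s ⟨q, hq, rfl⟩
    obtain ⟨n, rfl⟩ := hVφ v hv
    exact ⟨_, mul_mem (mul_mem (of_true_zpow_mem_posFalse n) of_false_mem_posFalse) hq, hmul n q⟩
  · rintro v hv v' hv' s ⟨q, hq, rfl⟩ s' ⟨q', hq', rfl⟩ he
    obtain ⟨n, rfl⟩ := hVφ v hv
    obtain ⟨m, rfl⟩ := hVφ v' hv'
    rw [hmul, hmul, mul_right_cancel_iff] at he
    rw [zpow_eq_of_mul_eq hq hq' (hφinj he)]

theorem pow_card_le_of_periods {A V : Finset (FreeGroup α)} (hV : V ⊆ A) (hV1 : 1 ∉ V)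
    (hVne : V.Nonempty)
    (hA : ¬ ∃ g : FreeGroup α, (A : Set (FreeGroup α)) ⊆ (Subgroup.zpowers g : Subgroup (FreeGroup α)))
    {r s : List (α × Bool)} (hr : ∀ v ∈ V, List.IsShortPeriod r v.toWord)
    (hs : ∀ v ∈ V, List.IsShortPeriod s v⁻¹.toWord) (k : ℕ) :
    V.card ^ (k + 1) ≤ (A ^ (2 * k + 1)).card := by
  obtain ⟨g, hg, hmin⟩ := V.exists_min_image norm hVne
  have hrg : r <+: g.toWord := List.prefix_of_prefix_length_le (List.prefix_append r _)
    (hr g hg).2.1 (by have := (hr g hg).2.2; omega)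
  have hrred : IsReduced r := isReduced_toWord.infix hrg.isInfix
  have hx : mk r ≠ 1 := by
    intro h
    have := congrArg toWord h
    rw [toWord_mk, hrred.reduce_eq, toWord_one] at this
    exact (hr g hg).1 this
  have hcoset : ∀ v ∈ V, Commute (mk r) (v * g⁻¹) := by
    intro v hv
    have hs1 : g⁻¹.toWord <+: v⁻¹.toWord := List.prefix_of_common_period (hs g hg).1
      (hs g hg).2.1 (hs v hv).2.1 (by
        have := hmin v hv
        rwa [← norm_inv_eq, ← norm_inv_eq (x := v)] at this)
    obtain ⟨t, ht⟩ := hs1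
    have hvt : v.toWord = invRev t ++ g.toWord := by
      have := congrArg invRev ht
      rw [invRev_append, ← toWord_inv, ← toWord_inv, inv_inv, inv_inv] at this
      exact this.symm
    have hvmk : v = mk (invRev t) * g := by
      rw [← mk_toWord (x := v), hvt, ← mul_mk, mk_toWord]
    have hcomm : invRev t ++ r = r ++ invRev t := by
      refine (List.prefix_of_prefix_length_le (l₃ := r ++ v.toWord) ?_ ?_ ?_).eq_of_length ?_
      · refine List.IsPrefix.trans ?_ (hr v hv).2.1
        rw [hvt]
        exact (List.prefix_append_right_inj _).2 hrg
      · rw [hvt]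
        exact (List.prefix_append_right_inj _).2 (List.prefix_append _ _)
      · simp; omega
      · simp; omega
    rw [hvmk, mul_inv_cancel_right]
    have := congrArg mk hcomm
    rw [← mul_mk, ← mul_mk] at this
    exact this.symm
  obtain ⟨h, hh, hgh⟩ : ∃ h ∈ A, ¬ Commute (mk r) (g * h) := by
    by_contra! hall
    have hg1 : g ≠ 1 := fun h => hV1 (h ▸ hg)
    have hgg : g * g ≠ 1 := by
      rw [← pow_two]
      exact fun h => hg1 (pow_eq_one_iff_left two_ne_zero |>.1 h)
    have hxg : Commute (mk r) g := commute_trans hgg (hall g (hV hg)).symm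
      ((Commute.refl g).mul_left (Commute.refl g))
    have hxA : ∀ a ∈ A, Commute (mk r) a := by
      intro a ha
      have := hxg.inv_right.mul_right (hall a ha)
      simpa using this
    exact hA (exists_zpowers_of_commute _ fun y hy z hz =>
      commute_trans hx (hxA y hy) (hxA z hz))
  exact pow_card_le_of_coset hV hx hh hgh hcoset k

/-- The growth estimate for two large sets `U`, `V` without mutual cancellation. -/
theorem pow_card_le_of_noCancel {A U V : Finset (FreeGroup α)}
    (hA : ¬ ∃ g : FreeGroup α, (A : Set (FreeGroup α)) ⊆ (Subgroup.zpowers g : Subgroup (FreeGroup α)))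
    (hU : U ⊆ A) (hV : V ⊆ A)
    (hVne : V.Nonempty) (hU1 : 1 ∉ U) (hV1 : 1 ∉ V) (huv : ∀ u ∈ U, ∀ v ∈ V, NoCancel u v)
    (hvu : ∀ u ∈ U, ∀ v ∈ V, NoCancel v u)
    (hlen : ∀ u ∈ U, ∀ u' ∈ U, ∀ v ∈ V, 2 * u'.norm ≤ 2 * u.norm + v.norm) (k : ℕ) :
    U.card ^ (k + 1) ≤ 6 ^ (k + 1) * (A ^ (2 * k + 1)).card ∨
      V.card ^ (k + 1) ≤ (A ^ (2 * k + 1)).card := by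
  rcases pow_card_le_or_exists_period hU hV hVne hU1 hV1 huv hvu hlen with h | ⟨r, hr⟩
  · exact .inl (h k)
  have hinv : ((A⁻¹) ^ (2 * k + 1)).card = (A ^ (2 * k + 1)).card := by
    rw [inv_pow, Finset.card_inv]
  rcases pow_card_le_or_exists_period (A := A⁻¹) (U := U⁻¹) (V := V⁻¹) (Finset.inv_subset_inv hU)
    (Finset.inv_subset_inv hV) hVne.inv (by simpa using hU1) (by simpa using hV1)
    (fun u hu v hv => by
      simpa using (hvu _ (Finset.mem_inv'.1 hu) _ (Finset.mem_inv'.1 hv)).inv)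
    (fun u hu v hv => by
      simpa using (huv _ (Finset.mem_inv'.1 hu) _ (Finset.mem_inv'.1 hv)).inv)
    (fun u hu u' hu' v hv => by
      simpa [norm_inv_eq] using hlen _ (Finset.mem_inv'.1 hu) _ (Finset.mem_inv'.1 hu') _
        (Finset.mem_inv'.1 hv)) with h | ⟨s, hs⟩
  · left
    simpa [hinv] using h k
  · right
    exact pow_card_le_of_periods hV hV1 hVne hA hr
      (fun v hv => hs _ (Finset.inv_mem_inv hv)) k

end FreeGroup

/-- If no value is too popular for `s` and `t` together, one can find two large subsets on which
the values of `s` avoid those of `t` on the other subset. -/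
theorem Finset.exists_large_avoiding {γ L : Type*} [DecidableEq L] (A : Finset γ)
    (s t : γ → L) (hA : A.Nonempty)
    (hst : ∀ e, (A.filter fun x => s x = e).card + (A.filter fun x => t x = e).card ≤ A.card) :
    ∃ X ⊆ A, ∃ Y ⊆ A, A.card ≤ 10 * X.card ∧ A.card ≤ 10 * Y.card ∧
      ∀ x ∈ X, ∀ y ∈ Y, t x ≠ s y ∧ t y ≠ s x := by
  by_contra hcon
  push Not at hcon
  have hApos := hA.card_pos
  let P (E : Finset L) := A.filter fun x => s x ∈ E ∧ t x ∈ E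
  let Q (E : Finset L) := A.filter fun x => s x ∈ E ∧ t x ∉ E
  let R (E : Finset L) := A.filter fun x => s x ∉ E ∧ t x ∈ E
  let N (E : Finset L) := A.filter fun x => s x ∉ E ∧ t x ∉ E
  have hs (E) : (A.filter fun x => s x ∈ E).card = (P E).card + (Q E).card := by
    rw [← Finset.card_filter_add_card_filter_not (s := A.filter fun x => s x ∈ E)
      (p := fun x => t x ∈ E), Finset.filter_filter, Finset.filter_filter]
  have ht (E) : (A.filter fun x => t x ∈ E).card = (P E).card + (R E).card := by
    rw [← Finset.card_filter_add_card_filter_not (s := A.filter fun x => t x ∈ E)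
      (p := fun x => s x ∈ E), Finset.filter_filter, Finset.filter_filter]
    simp only [P, R, and_comm]
  have hns (E) : (A.filter fun x => s x ∉ E).card = (R E).card + (N E).card := by
    rw [← Finset.card_filter_add_card_filter_not (s := A.filter fun x => s x ∉ E)
      (p := fun x => t x ∈ E), Finset.filter_filter, Finset.filter_filter]
  have hsum (E) : (P E).card + (Q E).card + (R E).card + (N E).card = A.card := by
    have := Finset.card_filter_add_card_filter_not (s := A) (p := fun x => s x ∈ E)
    rw [hs, hns] at this
    omega
  have hQ (E) : 10 * (Q E).card < A.card := by
    by_contra! h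
    obtain ⟨x, hx, y, hy, h⟩ := hcon (Q E) (Finset.filter_subset _ _) (Q E)
      (Finset.filter_subset _ _) h h
    simp only [Q, Finset.mem_filter] at hx hy
    exact hy.2.2 (h (fun h => hx.2.2 (h ▸ hy.2.1)) ▸ hx.2.1)
  have hR (E) : 10 * (R E).card < A.card := by
    by_contra! h
    obtain ⟨x, hx, y, hy, h⟩ := hcon (R E) (Finset.filter_subset _ _) (R E)
      (Finset.filter_subset _ _) h h
    simp only [R, Finset.mem_filter] at hx hy
    exact hx.2.1 (h (fun h => hy.2.1 (h ▸ hx.2.2)) ▸ hy.2.2)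
  have hPN (E) (h : A.card ≤ 10 * (P E).card) : 10 * (N E).card < A.card := by
    by_contra! h'
    obtain ⟨x, hx, y, hy, h⟩ := hcon (P E) (Finset.filter_subset _ _) (N E)
      (Finset.filter_subset _ _) h h'
    simp only [P, N, Finset.mem_filter] at hx hy
    exact hy.2.2 (h (fun h => hy.2.1 (h ▸ hx.2.2)) ▸ hx.2.1)
  have hsingle (e) : 10 * (P {e}).card < A.card := by
    by_contra! h
    have h1 := hst e
    have h2 := hs {e}
    have h3 := ht {e}
    have h4 := hPN _ h
    have h5 := hsum {e}
    simp only [Finset.mem_singleton] at h2 h3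
    omega
  have hall (E) : 10 * (P E).card < A.card := by
    classical
    induction E using Finset.induction_on with
    | empty => simpa [P] using hApos
    | insert e E he ih =>
      by_contra! h
      have h1 := hPN _ h
      have hsub : N {e} ∩ N E ⊆ N (insert e E) := by
        intro x hx
        simp only [N, Finset.mem_inter, Finset.mem_filter, Finset.mem_singleton,
          Finset.mem_insert] at hx ⊢
        tauto
      have h2 := Finset.card_le_card hsub
      have h3 := Finset.card_union_add_card_inter (N {e}) (N E)
      have h4 : (N {e} ∪ N E).card ≤ A.card := Finset.card_le_card
        (Finset.union_subset (Finset.filter_subset _ _) (Finset.filter_subset _ _))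
      have := hsingle e
      have := hsum E
      have := hsum {e}
      have := hQ E
      have := hQ {e}
      have := hR E
      have := hR {e}
      omega
  have h1 := hall (A.image s)
  have h2 := hQ (A.image s)
  have h3 := hs (A.image s)
  rw [Finset.filter_true_of_mem fun x hx => Finset.mem_image_of_mem s hx] at h3
  omega

/-- Given two finite sets and a size function, there are large parts of them such that the sizes on
one part are bounded by those on the other part and do not vary too much. -/
theorem Finset.exists_large_of_size {γ : Type*} (X Y : Finset γ) (f : γ → ℕ) (K : ℕ)
    (hX : K ≤ X.card) (hY : K ≤ Y.card) :
    ∃ U V : Finset γ, (U ⊆ X ∧ V ⊆ Y ∨ U ⊆ Y ∧ V ⊆ X) ∧ K ≤ 4 * U.card ∧ K ≤ 2 * V.card ∧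
      ∀ u ∈ U, ∀ u' ∈ U, ∀ v ∈ V, 2 * f u' ≤ 2 * f u + f v := by
  suffices ∃ (m : ℕ) (U V : Finset γ), (U ⊆ X ∧ V ⊆ Y ∨ U ⊆ Y ∧ V ⊆ X) ∧ K ≤ 2 * U.card ∧
      K ≤ 2 * V.card ∧ (∀ u ∈ U, f u ≤ m) ∧ ∀ v ∈ V, m ≤ f v by
    obtain ⟨m, U, V, hUV, hU, hV, hUm, hVm⟩ := this
    have hsplit := Finset.card_filter_add_card_filter_not (s := U) (p := fun u => 2 * f u ≤ m)
    have hsub : ∀ p : γ → Prop, ∀ [DecidablePred p],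
        (U.filter p ⊆ X ∧ V ⊆ Y ∨ U.filter p ⊆ Y ∧ V ⊆ X) := fun p _ =>
      hUV.imp (And.imp_left (Finset.filter_subset p U).trans)
        (And.imp_left (Finset.filter_subset p U).trans)
    rcases le_total (U.filter fun u => 2 * f u ≤ m).card (U.filter fun u => ¬ 2 * f u ≤ m).card
      with h | h
    · refine ⟨_, V, hsub fun u => ¬ 2 * f u ≤ m, by omega, hV, fun u hu u' hu' v hv => ?_⟩
      have := (Finset.mem_filter.1 hu).2
      have := hUm u' (Finset.mem_filter.1 hu').1
      have := hVm v hv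
      omega
    · refine ⟨_, V, hsub fun u => 2 * f u ≤ m, by omega, hV, fun u hu u' hu' v hv => ?_⟩
      have := (Finset.mem_filter.1 hu').2
      have := hVm v hv
      omega
  have hex : ∃ m, X.card ≤ 2 * (X.filter fun x => f x ≤ m).card :=
    ⟨X.sup f, by rw [Finset.filter_true_of_mem fun x hx => Finset.le_sup hx]; omega⟩
  classical
  set m := Nat.find hex
  have hm : X.card ≤ 2 * (X.filter fun x => f x ≤ m).card := Nat.find_spec hex
  have hm' : X.card ≤ 2 * (X.filter fun x => m ≤ f x).card := by
    rcases Nat.eq_zero_or_pos m with h0 | h0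
    · rw [h0]
      simp
      omega
    · have h1 := Nat.find_min hex (m := m - 1) (by omega)
      have h2 := Finset.card_filter_add_card_filter_not (s := X) (p := fun x => m ≤ f x)
      have h3 : (X.filter fun x => ¬ m ≤ f x) = X.filter fun x => f x ≤ m - 1 :=
        Finset.filter_congr fun x _ => by omega
      rw [h3] at h2
      omega
  have hYs := Finset.card_filter_add_card_filter_not (s := Y) (p := fun x => m ≤ f x)
  rcases le_total (Y.filter fun x => m ≤ f x).card (Y.filter fun x => ¬ m ≤ f x).card with h | h
  · refine ⟨m, Y.filter fun x => ¬ m ≤ f x, X.filter fun x => m ≤ f x,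
      .inr ⟨Finset.filter_subset _ _, Finset.filter_subset _ _⟩, by omega, by omega, ?_, ?_⟩
    · intro u hu
      have := (Finset.mem_filter.1 hu).2
      omega
    · exact fun v hv => (Finset.mem_filter.1 hv).2
  · exact ⟨m, X.filter fun x => f x ≤ m, Y.filter fun x => m ≤ f x,
      .inl ⟨Finset.filter_subset _ _, Finset.filter_subset _ _⟩, by omega, by omega,
      fun u hu => (Finset.mem_filter.1 hu).2, fun v hv => (Finset.mem_filter.1 hv).2⟩

namespace FreeGroup

variable {α : Type*} [DecidableEq α]

theorem noCancel_of_head_ne {x y : FreeGroup α} (h : x⁻¹.toWord.head? ≠ y.toWord.head?) :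
    NoCancel x y := by
  rw [noCancel_iff]
  refine List.isChain_append.2 ⟨isReduced_toWord, isReduced_toWord, ?_⟩
  rintro ⟨a, i⟩ ha ⟨b, j⟩ hb hab
  simp only at hab ⊢
  subst hab
  by_contra hij
  refine h ?_
  rw [Option.mem_def] at ha hb
  rw [hb, toWord_inv, invRev, List.head?_reverse, List.getLast?_map, ha]
  cases i <;> cases j <;> simp_all

theorem norm_inv_mul_le (e : α × Bool) (x : FreeGroup α) :
    norm ((mk [e])⁻¹ * x) + (if x.toWord.head? = some e then 2 else 0) ≤ norm x + 1 := by
  split_ifs with h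
  · obtain ⟨l, hl⟩ := List.head?_eq_some_iff.1 h
    have hx : x = mk [e] * mk l := by rw [mul_mk, ← mk_toWord (x := x), hl]; rfl
    have h1 : norm x = l.length + 1 := by rw [norm, hl]; rfl
    have h2 : norm ((mk [e])⁻¹ * x) ≤ l.length := by
      rw [hx, inv_mul_cancel_left]
      exact norm_mk_le
    omega
  · have h1 := norm_mul_le (mk [e])⁻¹ x
    have h2 : norm (mk [e]) ≤ 1 := norm_mk_le
    rw [norm_inv_eq] at h1
    omega

theorem norm_mul_mk_le (e : α × Bool) (x : FreeGroup α) :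
    norm (x * mk [e]) + (if x⁻¹.toWord.head? = some e then 2 else 0) ≤ norm x + 1 := by
  have := norm_inv_mul_le e x⁻¹
  rwa [← mul_inv_rev, norm_inv_eq, norm_inv_eq] at this

theorem norm_conj_le (e : α × Bool) (x : FreeGroup α) :
    norm ((mk [e])⁻¹ * x * mk [e]) + (if x.toWord.head? = some e then 2 else 0) +
      (if x⁻¹.toWord.head? = some e then 2 else 0) ≤ norm x + 2 := by
  by_cases h : x.toWord.head? = some e
  · obtain ⟨l, hl⟩ := List.head?_eq_some_iff.1 h
    have hx : x = mk [e] * mk l := by rw [mul_mk, ← mk_toWord (x := x), hl]; rfl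
    have hred : IsReduced l :=
      (isReduced_toWord (x := x)).infix ⟨[e], [], by simp [hl]⟩
    have hw : (mk l).toWord = l := by rw [toWord_mk, hred.reduce_eq]
    have h1 : norm x = l.length + 1 := by rw [norm, hl]; rfl
    have h2 : norm (mk l) = l.length := by rw [norm, hw]
    have h3 := norm_mul_mk_le e (mk l)
    have h4 : x⁻¹.toWord.head? = some e → (mk l)⁻¹.toWord.head? = some e := by
      rw [toWord_inv, toWord_inv, hl, hw]
      rcases eq_or_ne l [] with rfl | hne
      · obtain ⟨a, i⟩ := e
        cases i <;> simp [invRev]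
      · have : invRev l ≠ [] := by simpa [invRev] using hne
        rw [show e :: l = [e] ++ l from rfl, invRev_append, List.head?_append_of_ne_nil _ this]
        exact id
    have h5 : (mk [e])⁻¹ * x = mk l := by rw [hx, inv_mul_cancel_left]
    rw [h5]
    simp only [h, if_true]
    by_cases h6 : x⁻¹.toWord.head? = some e
    · simp only [h6, h4 h6, if_true] at h3 ⊢
      omega
    · simp only [h6, if_false]
      omega
  · have h1 := norm_inv_mul_le e (x * mk [e])
    have h2 := norm_mul_mk_le e x
    rw [← mul_assoc] at h1
    simp only [h, if_false]
    omega

theorem card_head_add_card_head_inv_le {A : Finset (FreeGroup α)} (hA : 2 ≤ A.card)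
    (hmin : ∀ g : FreeGroup α, ∑ a ∈ A, norm a ≤ ∑ a ∈ A, norm (g⁻¹ * a * g))
    (e : Option (α × Bool)) :
    (A.filter fun x => x.toWord.head? = e).card +
      (A.filter fun x => x⁻¹.toWord.head? = e).card ≤ A.card := by
  cases e with
  | none =>
    have h1 : (A.filter fun x => x.toWord.head? = none) ⊆ {1} := fun x hx => by
      simpa using (Finset.mem_filter.1 hx).2
    have h2 : (A.filter fun x => x⁻¹.toWord.head? = none) ⊆ {1} := fun x hx => by
      have := (Finset.mem_filter.1 hx).2
      rw [List.head?_eq_none_iff, toWord_eq_nil_iff, inv_eq_one] at this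
      simpa using this
    have := Finset.card_le_card h1
    have := Finset.card_le_card h2
    simp only [Finset.card_singleton] at *
    omega
  | some e =>
    have h1 := Finset.sum_le_sum fun x (_ : x ∈ A) => norm_conj_le e x
    simp only [Finset.sum_add_distrib, ← Finset.sum_filter, Finset.sum_const, smul_eq_mul] at h1
    have := hmin (mk [e])
    omega

theorem pow_card_le_of_energy_min {A : Finset (FreeGroup α)}
    (hA : ¬ ∃ g : FreeGroup α, (A : Set (FreeGroup α)) ⊆ (Subgroup.zpowers g : Subgroup (FreeGroup α)))
    (hc : 20 ≤ A.card)
    (hmin : ∀ g : FreeGroup α, ∑ a ∈ A, norm a ≤ ∑ a ∈ A, norm (g⁻¹ * a * g)) (k : ℕ) :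
    A.card ^ (k + 1) ≤ 480 ^ (k + 1) * (A ^ (2 * k + 1)).card := by
  obtain ⟨X, hX, Y, hY, hXc, hYc, hXY⟩ := A.exists_large_avoiding (fun x => x.toWord.head?)
    (fun x => x⁻¹.toWord.head?) (Finset.card_pos.1 (by omega))
    (card_head_add_card_head_inv_le (by omega) hmin)
  have hX1 := Finset.pred_card_le_card_erase (s := X) (a := 1)
  have hY1 := Finset.pred_card_le_card_erase (s := Y) (a := 1)
  obtain ⟨U, V, hUV, hU, hV, hlen⟩ := Finset.exists_large_of_size (X.erase 1) (Y.erase 1) norm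
    (min (X.erase 1).card (Y.erase 1).card) (min_le_left _ _) (min_le_right _ _)
  have hUc : A.card ≤ 80 * U.card := by omega
  have hVc : A.card ≤ 40 * V.card := by omega
  have hVne : V.Nonempty := Finset.card_pos.1 (by omega)
  have hNC : ∀ x ∈ X.erase 1, ∀ y ∈ Y.erase 1, NoCancel x y ∧ NoCancel y x := fun x hx y hy =>
    have := hXY x (Finset.mem_of_mem_erase hx) y (Finset.mem_of_mem_erase hy)
    ⟨noCancel_of_head_ne this.1, noCancel_of_head_ne this.2⟩
  have hXA := (X.erase_subset 1).trans hX
  have hYA := (Y.erase_subset 1).trans hY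
  have key : U.card ^ (k + 1) ≤ 6 ^ (k + 1) * (A ^ (2 * k + 1)).card ∨
      V.card ^ (k + 1) ≤ (A ^ (2 * k + 1)).card := by
    rcases hUV with ⟨hUX, hVY⟩ | ⟨hUY, hVX⟩
    · exact pow_card_le_of_noCancel hA (hUX.trans hXA) (hVY.trans hYA) hVne
        (fun h => by simpa using hUX h) (fun h => by simpa using hVY h)
        (fun u hu v hv => (hNC u (hUX hu) v (hVY hv)).1)
        (fun u hu v hv => (hNC u (hUX hu) v (hVY hv)).2) hlen k
    · exact pow_card_le_of_noCancel hA (hUY.trans hYA) (hVX.trans hXA) hVne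
        (fun h => by simpa using hUY h) (fun h => by simpa using hVX h)
        (fun u hu v hv => (hNC v (hVX hv) u (hUY hu)).2)
        (fun u hu v hv => (hNC v (hVX hv) u (hUY hu)).1) hlen k
  rcases key with h | h
  · calc A.card ^ (k + 1) ≤ (80 * U.card) ^ (k + 1) := by gcongr
      _ = 80 ^ (k + 1) * U.card ^ (k + 1) := mul_pow ..
      _ ≤ 80 ^ (k + 1) * (6 ^ (k + 1) * (A ^ (2 * k + 1)).card) := by gcongr
      _ = _ := by rw [← mul_assoc, ← mul_pow]; norm_num
  · calc A.card ^ (k + 1) ≤ (480 * V.card) ^ (k + 1) := by gcongr; omega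
      _ = 480 ^ (k + 1) * V.card ^ (k + 1) := mul_pow ..
      _ ≤ _ := by gcongr

/-- Growth of odd powers of finite subsets of a free group. -/
theorem pow_card_le_card_pow {A : Finset (FreeGroup α)} (hne : A.Nonempty)
    (hA : ¬ ∃ g : FreeGroup α, (A : Set (FreeGroup α)) ⊆ (Subgroup.zpowers g : Subgroup (FreeGroup α)))
    (k : ℕ) : A.card ^ (k + 1) ≤ 480 ^ (k + 1) * (A ^ (2 * k + 1)).card := by
  rcases lt_or_ge A.card 20 with hc | hc
  · calc A.card ^ (k + 1) ≤ 480 ^ (k + 1) * 1 := by rw [mul_one]; gcongr; omega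
      _ ≤ _ := by gcongr; exact hne.pow.card_pos
  obtain ⟨g, hg⟩ : ∃ g : FreeGroup α, ∀ h : FreeGroup α,
      ∑ a ∈ A, norm (g⁻¹ * a * g) ≤ ∑ a ∈ A, norm (h⁻¹ * a * h) := by
    let E (g : FreeGroup α) := ∑ a ∈ A, norm (g⁻¹ * a * g)
    exact ⟨Function.argmin E, fun h => Function.argmin_le E h⟩
  let c := (MulAut.conj g⁻¹).toMonoidHom
  have hcinj : Function.Injective c := (MulAut.conj g⁻¹).injective
  have hca (a) : c a = g⁻¹ * a * g := by simp [c]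
  have hcard (B : Finset (FreeGroup α)) : (B.image c).card = B.card :=
    Finset.card_image_of_injective _ hcinj
  have := pow_card_le_of_energy_min (A := A.image c) ?_ (by rwa [hcard]) ?_ k
  · rwa [← Finset.image_pow, hcard, hcard] at this
  · rintro ⟨w, hw⟩
    refine hA ⟨g * w * g⁻¹, fun a ha => ?_⟩
    obtain ⟨n, hn⟩ := hw (Finset.mem_coe.2 (Finset.mem_image_of_mem c ha))
    refine ⟨n, ?_⟩
    simp only [hca] at hn
    simp only [conj_zpow, hn]
    group
  · intro h
    rw [Finset.sum_image hcinj.injOn, Finset.sum_image hcinj.injOn]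
    simp only [hca]
    refine (hg (g * h)).trans_eq (Finset.sum_congr rfl fun a _ => ?_)
    congr 1
    group

end FreeGroup

/-- **Safin's theorem.** There is `c ∈ (0,1)` such that for every free group `F`,
every `n ≥ 3` and every finite nonempty subset `A ⊆ F` not contained in a cyclic
subgroup, one has `|Aⁿ| ≥ cⁿ·|A|^⌊(n+1)/2⌋`. -/
theorem safin_free_group :
    ∃ c : ℝ, 0 < c ∧ c < 1 ∧
      ∀ (α : Type*) [DecidableEq α] (n : ℕ), 3 ≤ n →
        ∀ A : Finset (FreeGroup α), A.Nonempty →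
          (¬ ∃ g : FreeGroup α,
              (A : Set (FreeGroup α)) ⊆ (Subgroup.zpowers g : Subgroup (FreeGroup α))) →
          ((A ^ n).card : ℝ) ≥ c ^ n * (A.card : ℝ) ^ ((n + 1) / 2) := by
  refine ⟨1 / 480, by norm_num, by norm_num, fun α _ n hn A hne hA => ?_⟩
  obtain ⟨k, hk⟩ : ∃ k, (n + 1) / 2 = k + 1 := ⟨(n + 1) / 2 - 1, by omega⟩
  rw [hk]
  have h1 : (A.card : ℝ) ^ (k + 1) ≤ 480 ^ (k + 1) * ((A ^ (2 * k + 1)).card : ℝ) := by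
    exact_mod_cast FreeGroup.pow_card_le_card_pow hne hA k
  have h2 : ((A ^ (2 * k + 1)).card : ℝ) ≤ (A ^ n).card := by
    exact_mod_cast hne.card_pow_mono (by omega : 2 * k + 1 ≤ n)
  have h3 : (1 / 480 : ℝ) ^ n ≤ (1 / 480) ^ (k + 1) :=
    pow_le_pow_of_le_one (by norm_num) (by norm_num) (by omega)
  calc (1 / 480 : ℝ) ^ n * (A.card : ℝ) ^ (k + 1)
      ≤ (1 / 480) ^ (k + 1) * (480 ^ (k + 1) * ((A ^ (2 * k + 1)).card : ℝ)) := by gcongr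
    _ = (A ^ (2 * k + 1)).card := by rw [← mul_assoc, ← mul_pow]; norm_num
    _ ≤ _ := h2
end

section
/- Let G be a group and A a finite nonempty subset with |A·A| = |A|. Then there is a finite subgroup H of G such that A = aH = Ha for every a ∈ A. -/
open Pointwise

/-- If `A` is a finite nonempty subset of a group `G` with `|A·A| = |A|`, then there is
a finite subgroup `H` of `G` such that `A = aH = Ha` for every `a ∈ A`. -/
theorem eq_coset_of_card_mul_eq {G : Type*} [Group G] [DecidableEq G]
    (A : Finset G) (hA : A.Nonempty) (h : (A * A).card = A.card) :
    ∃ H : Subgroup G, (H : Set G).Finite ∧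
      ∀ a ∈ A, (A : Set G) = {a} * (H : Set G) ∧ (A : Set G) = (H : Set G) * {a} := by
  have left (a : G) (ha : a ∈ A) :
      (A : Set G) = {a} * (MulAction.stabilizer G A : Set G) := by
    rw [Set.singleton_mul]
    exact (Finset.smul_stabilizer_of_no_doubling h.le ha).symm
  have right (a : G) (ha : a ∈ A) :
      (A : Set G) = (MulAction.stabilizer G A : Set G) * {a} := by
    rw [Set.mul_singleton]
    exact (Finset.op_smul_stabilizer_of_no_doubling h.le ha).symm
  refine ⟨MulAction.stabilizer G A, ?_, fun a ha => ⟨left a ha, right a ha⟩⟩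
  obtain ⟨a, ha⟩ := hA
  have hfin := A.finite_toSet
  rw [left a ha, Set.singleton_mul] at hfin
  exact hfin.of_finite_image (mul_right_injective a).injOn
end

section
/- Let G be a group and A a finite nonempty subset with |A·A| ≤ 1.1·|A|. Then there is a finite subgroup H of G and an element a ∈ A such that aHa⁻¹ = H, |H| ≤ 1.2·|A|, and A ⊆ aH. -/
open Pointwise

/-- If `A` is a finite nonempty subset of a group `G` with `|A·A| ≤ 1.1·|A|`, then there
is a finite subgroup `H` of `G` and `a ∈ A` with `aHa⁻¹ = H`, `|H| ≤ 1.2·|A|` and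
`A ⊆ aH`. -/
theorem subgroup_of_small_doubling {G : Type*} [Group G] [DecidableEq G]
    (A : Finset G) (hA : A.Nonempty) (h : ((A * A).card : ℝ) ≤ 1.1 * A.card) :
    ∃ H : Subgroup G, (H : Set G).Finite ∧ ∃ a ∈ A,
      (fun x => a * x * a⁻¹) '' (H : Set G) = (H : Set G) ∧
      (Nat.card H : ℝ) ≤ 1.2 * A.card ∧
      (A : Set G) ⊆ {a} * (H : Set G) := by
  have h32 : ((A * A).card : ℚ) < (3 / 2 : ℚ) * A.card := by
    have hpos : (0 : ℝ) < A.card := by exact_mod_cast hA.card_pos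
    have hreal : ((A * A).card : ℝ) < (3 / 2 : ℝ) * A.card := by linarith
    exact_mod_cast (by push_cast; exact hreal :
      (((A * A).card : ℚ) : ℝ) < (((3 / 2 : ℚ) * A.card : ℚ) : ℝ))
  obtain ⟨a, ha⟩ := hA
  have hcoe : (Finset.invMulSubgroup A h32 : Set G) = ((A⁻¹ * A : Finset G) : Set G) := by
    rw [Finset.invMulSubgroup_eq_inv_mul]
    push_cast
    rfl
  refine ⟨Finset.invMulSubgroup A h32, hcoe ▸ Finset.finite_toSet _, a, ha, ?_, ?_, ?_⟩
  · rw [hcoe]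
    have hconj := Finset.smul_inv_mul_eq_inv_mul_opSMul h32 ha
    ext y
    simp only [Set.mem_image, Finset.mem_coe]
    constructor
    · rintro ⟨x, hx, rfl⟩
      have hax := Finset.smul_mem_smul_finset (a := a) hx
      rw [hconj, Finset.mem_smul_finset] at hax
      obtain ⟨z, hz, hzx⟩ := hax
      simp only [MulOpposite.smul_eq_mul_unop, MulOpposite.unop_op, smul_eq_mul] at hzx
      rwa [← hzx, mul_inv_cancel_right]
    · intro hy
      have hya := Finset.smul_mem_smul_finset (a := MulOpposite.op a) hy
      rw [← hconj, Finset.mem_smul_finset] at hya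
      obtain ⟨z, hz, hzy⟩ := hya
      simp only [MulOpposite.smul_eq_mul_unop, MulOpposite.unop_op, smul_eq_mul] at hzy
      exact ⟨z, hz, by rw [hzy, mul_inv_cancel_right]⟩
  · have hcard : Nat.card (Finset.invMulSubgroup A h32) = (A * A).card := by
      rw [← Finset.card_inv_mul_of_doubling_lt_three_halves h32, ← Set.ncard_coe_finset, ← hcoe]
      rfl
    rw [hcard]
    have hnonneg : (0 : ℝ) ≤ A.card := Nat.cast_nonneg _
    linarith
  · intro x hx
    rw [hcoe]
    exact ⟨a, rfl, a⁻¹ * x,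
      Finset.mem_coe.2 (Finset.mul_mem_mul (Finset.inv_mem_inv ha) hx), mul_inv_cancel_left a x⟩
end
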